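/- Let D ⊂ R^n (n ≥ 2) be a bounded domain with C^2 boundary and p ∈ [1,∞). Then the embedding of Ŵ^{1,∞}_d(D) into L^p(D) is compact: every sequence (φ_m) with sup_m (‖φ_m‖_{L^p(D)} + ‖∇φ_m‖_{L^∞_d(D)}) < ∞ has a subsequence converging in L^p(D). -/

import Mathlib

open Metric MeasureTheory

noncomputable section

/-- A local graph representation of the boundary: near `x₀`, after a rotation `e`,
`Ω` coincides with the region above the graph of a `C^k` function `h` with `C^k`
norm at most `K`. -/
def IsCkGraphAt (n k : ℕ) (Ω : Set (EuclideanSpace ℝ (Fin n))) (α β K : ℝ)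
    (x₀ : EuclideanSpace ℝ (Fin n)) : Prop :=
  ∃ (e : EuclideanSpace ℝ (Fin n) ≃ₗᵢ[ℝ] WithLp 2 (EuclideanSpace ℝ (Fin (n - 1)) × ℝ))
    (h : EuclideanSpace ℝ (Fin (n - 1)) → ℝ),
    ContDiffOn ℝ (k : ℕ∞) h (ball 0 α) ∧ h 0 = 0 ∧
    fderivWithin ℝ h (ball 0 α) 0 = 0 ∧
    (∀ m : ℕ, m ≤ k → ∀ y' ∈ ball (0 : EuclideanSpace ℝ (Fin (n - 1))) α,
      ‖iteratedFDerivWithin ℝ m h (ball 0 α) y'‖ ≤ K) ∧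
    ∀ (y' : EuclideanSpace ℝ (Fin (n - 1))) (t : ℝ), ‖y'‖ < α → |t| < β →
      (x₀ + e.symm ((WithLp.equiv 2 (EuclideanSpace ℝ (Fin (n - 1)) × ℝ)).symm
        (y', h y' + t)) ∈ Ω ↔ 0 < t)

/-- A bounded domain (open connected bounded set) with `C^k` boundary. -/
def IsBoundedCkDomain (n k : ℕ) (D : Set (EuclideanSpace ℝ (Fin n))) : Prop :=
  IsOpen D ∧ IsConnected D ∧ Bornology.IsBounded D ∧
  ∀ x₀ ∈ frontier D, ∃ α > (0:ℝ), ∃ β > (0:ℝ), ∃ K : ℝ, IsCkGraphAt n k D α β K x₀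

/-- A uniformly `C^k` domain: graph representations with uniform constants `α, β, K`. -/
def IsUniformlyCkDomain (n k : ℕ) (Ω : Set (EuclideanSpace ℝ (Fin n))) : Prop :=
  IsOpen Ω ∧ IsConnected Ω ∧
  ∃ α > (0:ℝ), ∃ β > (0:ℝ), ∃ K : ℝ, ∀ x₀ ∈ frontier Ω, IsCkGraphAt n k Ω α β K x₀

end

section

open Set Filter Topology ENNReal

/-- The function `f` is differentiable on `D` and its gradient weighted by the distance to the
boundary is bounded by `B`. -/
def HasWeightedGradBound {E : Type*} [NormedAddCommGroup E] [NormedSpace ℝ E]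
    (D : Set E) (B : ℝ) (f : E → ℝ) : Prop :=
  DifferentiableOn ℝ f D ∧ ∀ x ∈ D, infDist x (frontier D) * ‖fderiv ℝ f x‖ ≤ B

theorem IsOpen.le_infDist_frontier {E : Type*} [PseudoMetricSpace E] {D : Set E} (hD : IsOpen D)
    (hfr : (frontier D).Nonempty) {x : E} {r : ℝ} (hball : ball x r ⊆ D) :
    r ≤ infDist x (frontier D) := by
  rw [le_infDist hfr]
  intro y hy
  by_contra! hlt
  have hyD : y ∈ D := hball (by rwa [mem_ball, dist_comm])
  rw [hD.frontier_eq] at hy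
  exact hy.2 hyD

namespace HasWeightedGradBound

variable {E : Type*} [NormedAddCommGroup E] [NormedSpace ℝ E] {D : Set E} {B : ℝ} {f : E → ℝ}

theorem norm_fderiv_le (hf : HasWeightedGradBound D B f) (hD : IsOpen D)
    (hfr : (frontier D).Nonempty) {x : E} {r : ℝ} (hr : 0 < r) (hball : ball x r ⊆ D) :
    ‖fderiv ℝ f x‖ ≤ B / r := by
  rw [le_div_iff₀ hr, mul_comm]
  exact (mul_le_mul_of_nonneg_right (hD.le_infDist_frontier hfr hball) (norm_nonneg _)).trans
    (hf.2 x (hball (mem_ball_self hr)))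

theorem nonneg (hf : HasWeightedGradBound D B f) (hD : D.Nonempty) : 0 ≤ B := by
  obtain ⟨x, hx⟩ := hD
  exact (mul_nonneg infDist_nonneg (norm_nonneg _)).trans (hf.2 x hx)

theorem abs_sub_le (hf : HasWeightedGradBound D B f) (hD : IsOpen D)
    (hfr : (frontier D).Nonempty) {x y : E} {r : ℝ} (hr : 0 < r) (hball : ball x r ⊆ D)
    (hy : y ∈ ball x (r / 2)) : |f y - f x| ≤ B / (r / 2) * ‖y - x‖ := by
  have hsub : ∀ z ∈ ball x (r / 2), ball z (r / 2) ⊆ D := fun z hz =>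
    (ball_subset_ball' (by rw [mem_ball] at hz; linarith)).trans hball
  refine (convex_ball x (r / 2)).norm_image_sub_le_of_norm_fderiv_le (𝕜 := ℝ) (f := f)
    (fun z hz => ?_) (fun z hz => ?_) (mem_ball_self (half_pos hr)) hy
  · exact hf.1.differentiableAt (hD.mem_nhds (hsub z hz (mem_ball_self (half_pos hr))))
  · exact hf.norm_fderiv_le hD hfr (half_pos hr) (hsub z hz)

theorem abs_le_of_eLpNorm_le [MeasurableSpace E] [BorelSpace E] [FiniteDimensional ℝ E]
    {μ : Measure E} [μ.IsAddHaarMeasure]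
    (hf : HasWeightedGradBound D B f) (hD : IsOpen D)
    (hfr : (frontier D).Nonempty) {q : ℝ≥0∞} (hq0 : q ≠ 0) (hqt : q ≠ ∞)
    (hLp : eLpNorm f q (μ.restrict D) ≤ ENNReal.ofReal B)
    {x : E} {r : ℝ} (hr : 0 < r) (hball : ball x r ⊆ D) :
    |f x| ≤ B + (ENNReal.ofReal B / μ (ball 0 (r / 2)) ^ (1 / q.toReal)).toReal := by
  have hr2 := half_pos hr
  set v := μ (ball (0 : E) (r / 2)) ^ (1 / q.toReal) with hv
  have hv0 : v ≠ 0 := by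
    rw [hv]
    exact (ENNReal.rpow_pos (measure_ball_pos μ _ hr2) measure_ball_lt_top.ne).ne'
  have hB : 0 ≤ B := hf.nonneg ⟨x, hball (mem_ball_self hr)⟩
  have hμ : μ (ball x (r / 2)) = μ (ball 0 (r / 2)) := Measure.addHaar_ball_center μ x _
  have hosc : ∀ y ∈ ball x (r / 2), |f x| - B ≤ |f y| := by
    intro y hy
    have h1 := hf.abs_sub_le hD hfr hr hball hy
    have h2 : B / (r / 2) * ‖y - x‖ ≤ B / (r / 2) * (r / 2) := by
      have : ‖y - x‖ ≤ r / 2 := by rw [← dist_eq_norm]; exact (mem_ball.1 hy).le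
      gcongr
    rw [div_mul_cancel₀ _ hr2.ne'] at h2
    have h3 := abs_sub_abs_le_abs_sub (f x) (f y)
    rw [abs_sub_comm] at h3
    linarith
  have key : ENNReal.ofReal (|f x| - B) * v ≤ ENNReal.ofReal B := by
    refine le_trans ?_ hLp
    refine le_trans ?_ (eLpNorm_mono_measure f
      (Measure.restrict_mono ((ball_subset_ball (half_le_self hr.le)).trans hball) le_rfl))
    have hc := eLpNorm_const' (μ := μ.restrict (ball x (r / 2))) (max (|f x| - B) 0) hq0 hqt
    rw [Measure.restrict_apply_univ, hμ, ← hv, Real.enorm_of_nonneg (le_max_right _ _)] at hc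
    have : ENNReal.ofReal (max (|f x| - B) 0) = ENNReal.ofReal (|f x| - B) := by
      rw [ENNReal.ofReal_max, ENNReal.ofReal_zero, max_eq_left zero_le]
    rw [this] at hc
    rw [← hc]
    refine eLpNorm_mono_ae ?_
    refine (ae_restrict_iff' measurableSet_ball).2 (Eventually.of_forall fun y hy => ?_)
    rw [Real.norm_of_nonneg (le_max_right _ _)]
    exact max_le (hosc y hy) (norm_nonneg _)
  have h1 : ENNReal.ofReal (|f x| - B) ≤ ENNReal.ofReal B / v := by
    rw [ENNReal.le_div_iff_mul_le (Or.inl hv0) (Or.inr ENNReal.ofReal_ne_top)]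
    exact key
  have := (ENNReal.ofReal_le_iff_le_toReal (ENNReal.div_ne_top ENNReal.ofReal_ne_top hv0)).1 h1
  linarith

end HasWeightedGradBound

/-- A pointwise bounded equicontinuous sequence of functions on a separable space has a pointwise
convergent subsequence. -/
theorem Equicontinuous.exists_subseq_tendsto {X : Type*} [TopologicalSpace X]
    [TopologicalSpace.SeparableSpace X] {F : ℕ → X → ℝ} (hF : Equicontinuous F)
    (hb : ∀ x, ∃ M, ∀ m, |F m x| ≤ M) :
    ∃ (g : ℕ → ℕ) (ψ : X → ℝ), StrictMono g ∧
      ∀ x, Tendsto (fun m => F (g m) x) atTop (𝓝 (ψ x)) := by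
  rcases isEmpty_or_nonempty X with hX | hX
  · exact ⟨id, fun _ => 0, strictMono_id, fun x => (hX.false x).elim⟩
  choose M hM using hb
  let u := TopologicalSpace.denseSeq X
  have hcomp : IsCompact (univ.pi fun k => Icc (-(M (u k))) (M (u k))) :=
    isCompact_univ_pi fun k => isCompact_Icc
  obtain ⟨a, -, g, hg, ha⟩ := hcomp.tendsto_subseq (x := fun m k => F m (u k))
    (fun m k _ => abs_le.1 (hM (u k) m))
  rw [tendsto_pi_nhds] at ha
  have hconv : ∀ x, ∃ l, Tendsto (fun m => F (g m) x) atTop (𝓝 l) := by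
    intro x
    refine cauchySeq_tendsto_of_complete (Metric.cauchySeq_iff'.2 fun ε hε => ?_)
    have hx := Metric.equicontinuousAt_iff_right.1 (hF x) (ε / 3) (by positivity)
    obtain ⟨k, hk⟩ := (TopologicalSpace.denseRange_denseSeq X).exists_mem_open
      isOpen_interior ⟨x, mem_interior_iff_mem_nhds.2 hx⟩
    have hk' := interior_subset hk
    obtain ⟨N, hN⟩ := Metric.cauchySeq_iff'.1 (ha k).cauchySeq (ε / 3) (by positivity)
    refine ⟨N, fun m hm => ?_⟩
    have h1 := hk' (g m)
    have h2 := hk' (g N)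
    have h3 := hN m hm
    simp only [Function.comp_apply] at h3
    rw [dist_comm] at h2
    have h4 := dist_triangle4 (F (g m) x) (F (g m) (u k)) (F (g N) (u k)) (F (g N) x)
    rw [dist_comm (F (g N) (u k))] at h4
    rw [dist_comm] at h2
    linarith
  choose ψ hψ using hconv
  exact ⟨g, ψ, hg, hψ⟩

theorem abs_sub_le_mul_log_of_abs_deriv_le {f f' : ℝ → ℝ} {C t T : ℝ} (ht : 0 < t) (htT : t ≤ T)
    (hf : ∀ s ∈ Icc t T, HasDerivAt f (f' s) s) (hf' : ∀ s ∈ Icc t T, |f' s| ≤ C / s) :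
    |f t - f T| ≤ C * Real.log (T / t) := by
  have hT : 0 < T := ht.trans_le htT
  have hmem : ∀ u ∈ Icc (Real.log t) (Real.log T), Real.exp u ∈ Icc t T := fun u hu =>
    ⟨(Real.log_le_iff_le_exp ht).1 hu.1, (Real.le_log_iff_exp_le hT).1 hu.2⟩
  have hlog : Real.log t ≤ Real.log T := Real.log_le_log ht htT
  have h := (convex_Icc (Real.log t) (Real.log T)).norm_image_sub_le_of_norm_hasDerivWithin_le
    (f := fun u => f (Real.exp u)) (f' := fun u => f' (Real.exp u) * Real.exp u) (C := C)
    (fun u hu => ((hf _ (hmem u hu)).comp u (Real.hasDerivAt_exp u)).hasDerivWithinAt)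
    (fun u hu => by
      rw [norm_mul, Real.norm_eq_abs, Real.norm_of_nonneg (Real.exp_pos u).le]
      exact (le_div_iff₀ (Real.exp_pos u)).1 (hf' _ (hmem u hu)))
    (right_mem_Icc.2 hlog) (left_mem_Icc.2 hlog)
  rw [Real.exp_log ht, Real.exp_log hT, Real.norm_eq_abs, Real.norm_eq_abs, abs_sub_comm (Real.log t),
    abs_of_nonneg (sub_nonneg.2 hlog)] at h
  rwa [Real.log_div hT.ne' ht.ne']

theorem lintegral_indicator_mul_comp_sub {X : Type*} [MeasurableSpace X] {μ : Measure X}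
    [SFinite μ] {S : Set X} (hS : MeasurableSet S) {h : X → ℝ} (hh : Measurable h)
    {G : ℝ → ℝ≥0∞} (hG : Measurable G) :
    ∫⁻ z, S.indicator 1 z.1 * G (z.2 - h z.1) ∂(μ.prod volume) = μ S * ∫⁻ t, G t := by
  have hmeas : Measurable fun z : X × ℝ => S.indicator (1 : X → ℝ≥0∞) z.1 * G (z.2 - h z.1) := by
    have : Measurable (S.indicator (1 : X → ℝ≥0∞)) := measurable_one.indicator hS
    fun_prop
  rw [lintegral_prod _ hmeas.aemeasurable]
  have hin : ∀ y, ∫⁻ s, S.indicator (1 : X → ℝ≥0∞) y * G (s - h y)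
      = S.indicator (1 : X → ℝ≥0∞) y * ∫⁻ t, G t := fun y => by
    rw [lintegral_const_mul _ (show Measurable fun s => G (s - h y) by fun_prop),
      lintegral_sub_right_eq_self G (h y)]
  simp only [hin]
  rw [lintegral_mul_const _ (measurable_one.indicator hS), lintegral_indicator_one hS]

theorem lintegral_ofReal_mul_div_rpow_half_ne_top (A T : ℝ) (hT : 0 < T) :
    ∫⁻ t, (Ioo 0 T).indicator (fun t => ENNReal.ofReal (A * (T / t) ^ (1 / 2 : ℝ))) t ≠ ∞ := by
  rw [lintegral_indicator measurableSet_Ioo]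
  have h1 : IntegrableOn (fun t : ℝ => A * T ^ (1 / 2 : ℝ) * t ^ (-(1 / 2) : ℝ)) (Ioo 0 T) :=
    ((intervalIntegral.integrableOn_Ioo_rpow_iff hT).2 (by norm_num)).const_mul _
  have h2 : IntegrableOn (fun t : ℝ => A * (T / t) ^ (1 / 2 : ℝ)) (Ioo 0 T) := by
    refine h1.congr_fun (fun t ht => ?_) measurableSet_Ioo
    simp only []
    rw [Real.div_rpow hT.le ht.1.le, Real.rpow_neg ht.1.le]
    ring
  exact h2.lintegral_lt_top.ne

theorem IsCkGraphAt.exists_lipschitz_graph {n k : ℕ} {D : Set (EuclideanSpace ℝ (Fin n))}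
    {α β K : ℝ} {x₀ : EuclideanSpace ℝ (Fin n)} (hk : 1 ≤ k) (hα : 0 < α)
    (hch : IsCkGraphAt n k D α β K x₀) :
    0 ≤ K ∧ ∃ (e : EuclideanSpace ℝ (Fin n) ≃ₗᵢ[ℝ]
        WithLp 2 (EuclideanSpace ℝ (Fin (n - 1)) × ℝ))
      (h : EuclideanSpace ℝ (Fin (n - 1)) → ℝ), h 0 = 0 ∧
      (∀ y ∈ ball 0 α, ∀ z ∈ ball 0 α, |h z - h y| ≤ K * ‖z - y‖) ∧
      ∀ y t, ‖y‖ < α → |t| < β → (x₀ + e.symm (WithLp.toLp 2 (y, h y + t)) ∈ D ↔ 0 < t) := by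
  obtain ⟨e, h, hC, h0, -, hK, hgr⟩ := hch
  refine ⟨(norm_nonneg _).trans (hK 0 (Nat.zero_le _) 0 (mem_ball_self hα)), e, h, h0, ?_, hgr⟩
  intro y hy z hz
  have hk' : ((k : ℕ∞) : WithTop ℕ∞) ≠ 0 := by
    simp only [ne_eq]
    norm_cast
    omega
  exact (convex_ball _ α).norm_image_sub_le_of_norm_fderivWithin_le (𝕜 := ℝ)
    (hC.differentiableOn hk') (fun w hw => by
      rw [← norm_iteratedFDerivWithin_one h (isOpen_ball.uniqueDiffWithinAt hw)]
      exact hK 1 hk w hw) hy hz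

section Graph

variable {V : Type*} [NormedAddCommGroup V] [InnerProductSpace ℝ V]
  {E : Type*} [NormedAddCommGroup E] [InnerProductSpace ℝ E]
  {D : Set E} {α β K : ℝ} {x₀ : E} {e : E ≃ₗᵢ[ℝ] WithLp 2 (V × ℝ)} {h : V → ℝ}

theorem ball_subset_of_lipschitz_graph (hK : 0 ≤ K)
    (hlip : ∀ y ∈ ball 0 α, ∀ z ∈ ball 0 α, |h z - h y| ≤ K * ‖z - y‖)
    (hgr : ∀ y t, ‖y‖ < α → |t| < β → (x₀ + e.symm (WithLp.toLp 2 (y, h y + t)) ∈ D ↔ 0 < t))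
    {y : V} {t : ℝ} (hy : ‖y‖ < α / 2) (ht : 0 < t) (htα : t ≤ α / 2) (htβ : 2 * t < β) :
    ball (x₀ + e.symm (WithLp.toLp 2 (y, h y + t))) (t / (1 + K)) ⊆ D := by
  intro z hz
  have hK1 : 0 < 1 + K := by linarith
  set r := t / (1 + K) with hr
  have hrt : r * (1 + K) = t := div_mul_cancel₀ _ hK1.ne'
  have hr0 : 0 < r := div_pos ht hK1
  have hrle : r ≤ t := by nlinarith
  set w := e (z - x₀) with hw
  have hzw : z = x₀ + e.symm w := by simp [hw]
  have hd : ‖w - WithLp.toLp 2 (y, h y + t)‖ < r := by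
    rw [mem_ball, dist_eq_norm] at hz
    rw [← e.symm.norm_map, map_sub]
    convert hz using 2
    rw [hzw]
    abel
  have h1 : ‖w.fst - y‖ < r := (WithLp.norm_fst_le _ (w - WithLp.toLp 2 (y, h y + t))).trans_lt hd
  have h2 : ‖w.snd - (h y + t)‖ < r :=
    (WithLp.norm_snd_le _ (w - WithLp.toLp 2 (y, h y + t))).trans_lt hd
  have hwα : ‖w.fst‖ < α := by
    have := norm_le_norm_add_norm_sub' w.fst y
    linarith
  have h3 := hlip y (by simp; linarith [norm_nonneg y]) w.fst (by simpa using hwα)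
  have h4 : K * ‖w.fst - y‖ ≤ K * r := by gcongr
  rw [Real.norm_eq_abs, abs_lt] at h2
  rw [abs_le] at h3
  have hpos : 0 < w.snd - h w.fst := by nlinarith
  have hlt : w.snd - h w.fst < β := by nlinarith
  have := (hgr w.fst (w.snd - h w.fst) hwα (by rwa [abs_of_pos hpos])).2 hpos
  rw [add_sub_cancel] at this
  rw [hzw]
  exact this

theorem HasWeightedGradBound.abs_sub_le_mul_log {B : ℝ} {f : E → ℝ}
    (hf : HasWeightedGradBound D B f) (hD : IsOpen D) (hfr : (frontier D).Nonempty) (hK : 0 ≤ K)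
    (hlip : ∀ y ∈ ball 0 α, ∀ z ∈ ball 0 α, |h z - h y| ≤ K * ‖z - y‖)
    (hgr : ∀ y t, ‖y‖ < α → |t| < β → (x₀ + e.symm (WithLp.toLp 2 (y, h y + t)) ∈ D ↔ 0 < t))
    {y : V} {t T : ℝ} (hy : ‖y‖ < α / 2) (ht : 0 < t) (htT : t ≤ T) (hTα : T ≤ α / 2)
    (hTβ : 2 * T < β) :
    |f (x₀ + e.symm (WithLp.toLp 2 (y, h y + t))) - f (x₀ + e.symm (WithLp.toLp 2 (y, h y + T)))|
      ≤ B * (1 + K) * Real.log (T / t) := by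
  have hK1 : 0 < 1 + K := by linarith
  set v : E := e.symm (WithLp.toLp 2 (0, 1)) with hv
  have hvn : ‖v‖ = 1 := by
    rw [hv, LinearIsometryEquiv.norm_map, WithLp.norm_toLp_snd]
    simp
  have hγ : ∀ s, x₀ + e.symm (WithLp.toLp 2 (y, h y + s))
      = x₀ + e.symm (WithLp.toLp 2 (y, h y)) + s • v := fun s => by
    rw [hv, ← map_smul, add_assoc, ← map_add, ← WithLp.toLp_smul, ← WithLp.toLp_add]
    simp
  have hball : ∀ s ∈ Icc t T, ball (x₀ + e.symm (WithLp.toLp 2 (y, h y + s))) (s / (1 + K)) ⊆ D :=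
    fun s hs => ball_subset_of_lipschitz_graph hK hlip hgr hy (ht.trans_le hs.1)
      (hs.2.trans hTα) (by linarith [hs.2])
  refine abs_sub_le_mul_log_of_abs_deriv_le
    (f := fun s => f (x₀ + e.symm (WithLp.toLp 2 (y, h y + s))))
    (f' := fun s => fderiv ℝ f (x₀ + e.symm (WithLp.toLp 2 (y, h y + s))) v) ht htT
    (fun s hs => ?_) (fun s hs => ?_)
  · have hs0 : 0 < s / (1 + K) := div_pos (ht.trans_le hs.1) hK1
    have hd := (hf.1.differentiableAt (hD.mem_nhds (hball s hs (mem_ball_self hs0)))).hasFDerivAt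
    refine hd.comp_hasDerivAt s ?_
    simp only [hγ]
    simpa using ((hasDerivAt_id s).smul_const v).const_add (x₀ + e.symm (WithLp.toLp 2 (y, h y)))
  · have hs0 : 0 < s / (1 + K) := div_pos (ht.trans_le hs.1) hK1
    rw [← Real.norm_eq_abs]
    refine (ContinuousLinearMap.le_opNorm _ _).trans ?_
    rw [hvn, mul_one]
    refine (hf.norm_fderiv_le hD hfr hs0 (hball s hs)).trans_eq ?_
    rw [div_div_eq_mul_div]

end Graph

theorem one_add_mul_log_le {M C p u : ℝ} (hM : 0 ≤ M) (hC : 0 ≤ C) (hp : 0 < p) (hu : 1 ≤ u) :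
    (M + C * Real.log u) ^ p ≤ (M + C * (2 * p)) ^ p * u ^ (1 / 2 : ℝ) := by
  have hu0 : 0 ≤ u := zero_le_one.trans hu
  have ha : 0 < 1 / (2 * p) := by positivity
  have h1 := Real.log_le_rpow_div hu0 ha
  rw [div_div_eq_mul_div, div_one] at h1
  have h2 := Real.one_le_rpow hu ha.le
  have h3 : M + C * Real.log u ≤ (M + C * (2 * p)) * u ^ (1 / (2 * p)) := by
    have h4 : C * Real.log u ≤ C * (u ^ (1 / (2 * p)) * (2 * p)) := by gcongr
    nlinarith
  have h0 : 0 ≤ M + C * Real.log u := add_nonneg hM (mul_nonneg hC (Real.log_nonneg hu))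
  refine (Real.rpow_le_rpow h0 h3 hp.le).trans_eq ?_
  rw [Real.mul_rpow (by positivity) (by positivity), ← Real.rpow_mul hu0]
  congr 2
  field_simp

theorem IsCkGraphAt.exists_nhds_dominating {n k : ℕ} {D : Set (EuclideanSpace ℝ (Fin n))}
    {α β K : ℝ} {x₀ : EuclideanSpace ℝ (Fin n)} (hk : 1 ≤ k) (hα : 0 < α) (hβ : 0 < β)
    (hch : IsCkGraphAt n k D α β K x₀) (hD : IsOpen D) (hfr : (frontier D).Nonempty)
    {B p : ℝ} (hB : 0 ≤ B) (hp : 0 < p) {ι : Type*} {φ : ι → EuclideanSpace ℝ (Fin n) → ℝ}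
    (hφ : ∀ m, HasWeightedGradBound D B (φ m))
    (hb : ∀ r > 0, ∃ M, ∀ m x, ball x r ⊆ D → |φ m x| ≤ M) :
    ∃ U ∈ 𝓝 x₀, ∃ F : EuclideanSpace ℝ (Fin n) → ℝ≥0∞, Measurable F ∧ ∫⁻ x, F x ≠ ∞ ∧
      ∀ m, ∀ x ∈ U ∩ D, ‖φ m x‖ₑ ^ p ≤ F x := by
  classical
  obtain ⟨hK, e, h, h0, hlip, hgr⟩ := hch.exists_lipschitz_graph hk hα
  have hK1 : 0 < 1 + K := by linarith
  set T := min (α / 2) (β / 3) with hT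
  have hT0 : 0 < T := lt_min (by positivity) (by positivity)
  have hTα : T ≤ α / 2 := min_le_left _ _
  have hTβ : 2 * T < β := by linarith [min_le_right (α / 2) (β / 3)]
  obtain ⟨M₀, hM₀⟩ := hb (T / (1 + K)) (div_pos hT0 hK1)
  set M := max M₀ 0
  have hM : 0 ≤ M := le_max_right _ _
  have hcont : ContinuousOn h (ball 0 α) := by
    refine LipschitzOnWith.continuousOn (K := K.toNNReal)
      (LipschitzOnWith.of_dist_le_mul fun z hz y hy => ?_)
    rw [Real.coe_toNNReal _ hK, dist_eq_norm, dist_eq_norm]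
    exact hlip y hy z hz
  let h' : EuclideanSpace ℝ (Fin (n - 1)) → ℝ := (ball 0 α).piecewise h 0
  have hh' : Measurable h' :=
    hcont.measurable_piecewise continuous_zero.continuousOn measurableSet_ball
  have hh'eq : ∀ y, ‖y‖ < α → h' y = h y := fun y hy =>
    piecewise_eq_of_mem _ _ _ (by simpa using hy)
  let L : EuclideanSpace ℝ (Fin n) → EuclideanSpace ℝ (Fin (n - 1)) × ℝ :=
    fun x => WithLp.ofLp (e (x - x₀))
  have hLc : Continuous L :=
    (WithLp.prod_continuous_ofLp 2 _ _).comp (e.continuous.comp (continuous_id.sub continuous_const))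
  have hLmp : MeasurePreserving L :=
    (WithLp.volume_preserving_ofLp _ _).comp
      (e.measurePreserving.comp (measurePreserving_sub_right volume x₀))
  have hL0 : L x₀ = 0 := by simp [L]
  have hLx : ∀ x, x = x₀ + e.symm (WithLp.toLp 2 ((L x).1, h (L x).1 + ((L x).2 - h (L x).1))) :=
    fun x => by
      rw [add_sub_cancel]
      change x = x₀ + e.symm (WithLp.toLp 2 (WithLp.ofLp (e (x - x₀))))
      simp
  set A := (M + B * (1 + K) * (2 * p)) ^ p
  let G : ℝ → ℝ≥0∞ :=
    (Ioo 0 T).indicator fun t => ENNReal.ofReal (A * (T / t) ^ (1 / 2 : ℝ))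
  have hG : Measurable G := Measurable.indicator (by fun_prop) measurableSet_Ioo
  let S : Set (EuclideanSpace ℝ (Fin (n - 1))) := ball 0 (α / 2)
  let f : EuclideanSpace ℝ (Fin (n - 1)) × ℝ → ℝ≥0∞ :=
    fun z => S.indicator 1 z.1 * G (z.2 - h' z.1)
  have hf : Measurable f := by
    have : Measurable (S.indicator (1 : EuclideanSpace ℝ (Fin (n - 1)) → ℝ≥0∞)) :=
      measurable_one.indicator measurableSet_ball
    fun_prop
  refine ⟨{x | ‖(L x).1‖ < α / 2 ∧ |(L x).2 - h (L x).1| < T}, ?_, fun x => f (L x),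
    hf.comp hLmp.measurable, ?_, ?_⟩
  · have hc1 : ContinuousAt (fun x => ‖(L x).1‖) x₀ := (hLc.fst.norm).continuousAt
    have hc2 : ContinuousAt (fun x => |(L x).2 - h (L x).1|) x₀ := by
      refine (hLc.snd.continuousAt.sub ?_).abs
      refine ContinuousAt.comp (f := fun x => (L x).1) ?_ hLc.fst.continuousAt
      rw [hL0]
      exact hcont.continuousAt (isOpen_ball.mem_nhds (mem_ball_self hα))
    exact (hc1.eventually_lt_const (by simpa [hL0] using hα)).and
      (hc2.eventually_lt_const (by simpa [hL0, h0] using hT0))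
  · rw [hLmp.lintegral_comp hf]
    have := lintegral_indicator_mul_comp_sub (μ := volume) (S := S) measurableSet_ball hh' hG
    rw [show (volume : Measure (EuclideanSpace ℝ (Fin (n - 1)) × ℝ)) = volume.prod volume from rfl,
      this]
    exact ENNReal.mul_ne_top measure_ball_lt_top.ne
      (lintegral_ofReal_mul_div_rpow_half_ne_top A T hT0)
  · rintro m x ⟨⟨hx1, hxT⟩, hxD⟩
    set y := (L x).1
    set t := (L x).2 - h y
    have hyα : ‖y‖ < α := by linarith
    have hx2 : t < T := (le_abs_self t).trans_lt hxT
    have ht0 : 0 < t := by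
      refine (hgr y t hyα (by linarith)).1 ?_
      rw [← hLx x]
      exact hxD
    have hval : f (L x) = ENNReal.ofReal (A * (T / t) ^ (1 / 2 : ℝ)) := by
      have hyS : y ∈ S := by simpa [S] using hx1
      have : (L x).2 - h' y = t := by rw [hh'eq y hyα]
      simp only [f]
      rw [indicator_of_mem hyS, this, Pi.one_apply, one_mul]
      exact indicator_of_mem (show t ∈ Ioo 0 T from ⟨ht0, hx2⟩) _
    have hlog := (hφ m).abs_sub_le_mul_log hD hfr hK hlip hgr hx1 ht0 hx2.le hTα hTβ
    rw [← hLx x] at hlog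
    have hMx := hM₀ m _ (ball_subset_of_lipschitz_graph hK hlip hgr hx1 hT0 hTα hTβ)
    have habs : |φ m x| ≤ M + B * (1 + K) * Real.log (T / t) := by
      have := abs_sub_abs_le_abs_sub (φ m x) (φ m (x₀ + e.symm (WithLp.toLp 2 (y, h y + T))))
      linarith [le_max_left M₀ 0]
    change _ ≤ f (L x)
    rw [hval, Real.enorm_eq_ofReal_abs, ENNReal.ofReal_rpow_of_nonneg (abs_nonneg _) hp.le]
    refine ENNReal.ofReal_le_ofReal ((Real.rpow_le_rpow (abs_nonneg _) habs hp.le).trans ?_)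
    exact one_add_mul_log_le hM (by positivity) hp ((one_le_div ht0).2 hx2.le)

theorem exists_dominating_of_forall_nhds {X : Type*} [TopologicalSpace X] [MeasurableSpace X]
    {μ : Measure X} {D : Set X} (hD : IsCompact (closure D)) {ι : Type*} {w : ι → X → ℝ≥0∞}
    (hloc : ∀ x ∈ closure D, ∃ U ∈ 𝓝 x, ∃ F : X → ℝ≥0∞, Measurable F ∧ ∫⁻ x, F x ∂μ ≠ ∞ ∧
      ∀ m, ∀ x ∈ U ∩ D, w m x ≤ F x) :
    ∃ F : X → ℝ≥0∞, Measurable F ∧ ∫⁻ x, F x ∂μ ≠ ∞ ∧ ∀ m, ∀ x ∈ D, w m x ≤ F x := by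
  obtain ⟨F, hF, hFi, hFb⟩ := hD.induction_on
    (p := fun s => ∃ F : X → ℝ≥0∞, Measurable F ∧ ∫⁻ x, F x ∂μ ≠ ∞ ∧
      ∀ m, ∀ x ∈ s ∩ D, w m x ≤ F x)
    ⟨0, measurable_zero, by simp, by simp⟩
    (fun s t hst ⟨F, hF, hFi, hFb⟩ => ⟨F, hF, hFi, fun m x hx => hFb m x ⟨hst hx.1, hx.2⟩⟩)
    (fun s t ⟨F, hF, hFi, hFb⟩ ⟨F', hF', hFi', hFb'⟩ => ⟨fun x => F x + F' x, hF.add hF', by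
      rw [lintegral_add_left hF]
      exact ENNReal.add_ne_top.2 ⟨hFi, hFi'⟩, fun m x hx => hx.1.elim
        (fun h => (hFb m x ⟨h, hx.2⟩).trans le_self_add)
        (fun h => (hFb' m x ⟨h, hx.2⟩).trans le_add_self)⟩)
    (fun x hx => by
      obtain ⟨U, hU, hP⟩ := hloc x hx
      exact ⟨U, mem_nhdsWithin_of_mem_nhds hU, hP⟩)
  exact ⟨F, hF, hFi, fun m x hx => hFb m x ⟨subset_closure hx, hx⟩⟩

theorem tendsto_eLpNorm_sub_of_dominated {X : Type*} [MeasurableSpace X] {μ : Measure X}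
    {p : ℝ} (hp : 1 ≤ p) {f : ℕ → X → ℝ} {ψ : X → ℝ} (hf : ∀ m, AEMeasurable (f m) μ)
    {F : X → ℝ≥0∞} (hF : ∫⁻ x, F x ∂μ ≠ ∞) (hdom : ∀ m, ∀ᵐ x ∂μ, ‖f m x‖ₑ ^ p ≤ F x)
    (hlim : ∀ᵐ x ∂μ, Tendsto (fun m => f m x) atTop (𝓝 (ψ x))) :
    Tendsto (fun m => eLpNorm (fun x => f m x - ψ x) (ENNReal.ofReal p) μ) atTop (𝓝 0) := by
  have hp0 : 0 < p := by linarith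
  have hψ : AEMeasurable ψ μ := aemeasurable_of_tendsto_metrizable_ae atTop hf hlim
  have hψF : ∀ᵐ x ∂μ, ‖ψ x‖ₑ ^ p ≤ F x := by
    filter_upwards [hlim, ae_all_iff.2 hdom] with x hx hd
    exact le_of_tendsto ((ENNReal.continuous_rpow_const.tendsto _).comp hx.enorm)
      (Eventually.of_forall hd)
  have hmain : Tendsto (fun m => ∫⁻ x, ‖f m x - ψ x‖ₑ ^ p ∂μ) atTop (𝓝 (∫⁻ _, 0 ∂μ)) := by
    refine tendsto_lintegral_of_dominated_convergence' (fun x => 2 ^ (p - 1) * 2 * F x)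
      (fun m => ((hf m).sub hψ).enorm.pow_const p) (fun m => ?_) ?_ ?_
    · filter_upwards [hdom m, hψF] with x h1 h2
      calc ‖f m x - ψ x‖ₑ ^ p ≤ (‖f m x‖ₑ + ‖ψ x‖ₑ) ^ p := by
            gcongr
            exact enorm_sub_le
        _ ≤ 2 ^ (p - 1) * (‖f m x‖ₑ ^ p + ‖ψ x‖ₑ ^ p) :=
            ENNReal.rpow_add_le_mul_rpow_add_rpow _ _ hp
        _ ≤ 2 ^ (p - 1) * (F x + F x) := by gcongr
        _ = 2 ^ (p - 1) * 2 * F x := by rw [← two_mul, mul_assoc]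
    · have hc : (2 : ℝ≥0∞) ^ (p - 1) * 2 ≠ ∞ :=
        ENNReal.mul_ne_top (ENNReal.rpow_ne_top_of_nonneg (by linarith) ENNReal.ofNat_ne_top)
          ENNReal.ofNat_ne_top
      rw [lintegral_const_mul' _ _ hc]
      exact ENNReal.mul_ne_top hc hF
    · filter_upwards [hlim] with x hx
      have h1 : Tendsto (fun m => ‖f m x - ψ x‖ₑ ^ p) atTop (𝓝 (‖ψ x - ψ x‖ₑ ^ p)) :=
        (ENNReal.continuous_rpow_const.tendsto _).comp (hx.sub_const _).enorm
      simpa [hp0] using h1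
  have h2 := (ENNReal.continuous_rpow_const (y := 1 / p)).tendsto _ |>.comp hmain
  simp only [lintegral_zero] at h2
  rw [ENNReal.zero_rpow_of_pos (by positivity)] at h2
  refine h2.congr fun m => ?_
  rw [eLpNorm_eq_lintegral_rpow_enorm_toReal (by simpa using hp0) ENNReal.ofReal_ne_top,
    ENNReal.toReal_ofReal hp0.le]
  rfl

theorem HasWeightedGradBound.equicontinuous_domRestrict {E : Type*} [NormedAddCommGroup E]
    [NormedSpace ℝ E] {D : Set E} {B : ℝ} {ι : Type*} {φ : ι → E → ℝ}
    (hφ : ∀ m, HasWeightedGradBound D B (φ m)) (hD : IsOpen D) (hfr : (frontier D).Nonempty) :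
    Equicontinuous fun m => D.domRestrict (φ m) := by
  rintro ⟨x, hx⟩
  obtain ⟨r, hr, hball⟩ := Metric.isOpen_iff.1 hD x hx
  refine Metric.equicontinuousAt_of_continuity_modulus
    (fun y : D => B / (r / 2) * ‖(y : E) - x‖) ?_ _ ?_
  · have : Continuous fun y : D => B / (r / 2) * ‖(y : E) - x‖ := by fun_prop
    simpa using this.tendsto ⟨x, hx⟩
  · have : ∀ᶠ y : D in 𝓝 ⟨x, hx⟩, (y : E) ∈ ball x (r / 2) :=
      continuous_subtype_val.continuousAt.eventually (ball_mem_nhds x (half_pos hr))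
    filter_upwards [this] with y hy m
    rw [dist_comm, Real.dist_eq]
    exact (hφ m).abs_sub_le hD hfr hr hball hy

theorem IsBoundedCkDomain.frontier_nonempty {n k : ℕ} {D : Set (EuclideanSpace ℝ (Fin n))}
    (hD : IsBoundedCkDomain n k D) (hn : n ≠ 0) : (frontier D).Nonempty := by
  have : Nonempty (Fin n) := ⟨⟨0, Nat.pos_of_ne_zero hn⟩⟩
  rw [nonempty_iff_ne_empty, ne_eq, frontier_eq_empty_iff]
  rintro (h | h)
  · exact hD.2.1.nonempty.ne_empty h
  · exact NormedSpace.unbounded_univ ℝ (EuclideanSpace ℝ (Fin n)) (h ▸ hD.2.2.1)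

end

/-- compact embedding of `Ŵ^{1,∞}_d(D)` into `L^p(D)` for a bounded
`C²` domain: any sequence bounded in `L^p` norm and weighted-gradient sup norm has a
subsequence converging in `L^p(D)`. -/
theorem stmt2 (n : ℕ) (hn : 2 ≤ n) (D : Set (EuclideanSpace ℝ (Fin n)))
    (hD : IsBoundedCkDomain n 2 D) (p : ℝ) (hp : 1 ≤ p)
    (φ : ℕ → EuclideanSpace ℝ (Fin n) → ℝ)
    (hdiff : ∀ m, DifferentiableOn ℝ (φ m) D)
    (B : ℝ)
    (hLp : ∀ m, eLpNorm (φ m) (ENNReal.ofReal p) (volume.restrict D) ≤ ENNReal.ofReal B)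
    (hgrad : ∀ m, ∀ x ∈ D, infDist x (frontier D) * ‖fderivWithin ℝ (φ m) D x‖ ≤ B) :
    ∃ (g : ℕ → ℕ) (ψ : EuclideanSpace ℝ (Fin n) → ℝ), StrictMono g ∧
      Filter.Tendsto
        (fun m => eLpNorm (fun x => φ (g m) x - ψ x) (ENNReal.ofReal p) (volume.restrict D))
        Filter.atTop (nhds 0) := by

  obtain ⟨hDo, hDc, hDb, hch⟩ := id hD
  have hp0 : 0 < p := by linarith
  have hq0 : ENNReal.ofReal p ≠ 0 := by simpa using hp0
  have hfr := hD.frontier_nonempty (by omega)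
  have hφ : ∀ m, HasWeightedGradBound D B (φ m) := fun m =>
    ⟨hdiff m, fun x hx => by simpa only [fderivWithin_of_isOpen hDo hx] using hgrad m x hx⟩
  have hb : ∀ r > 0, ∃ M, ∀ m x, ball x r ⊆ D → |φ m x| ≤ M := fun r hr =>
    ⟨_, fun m x hx => (hφ m).abs_le_of_eLpNorm_le hDo hfr hq0 ENNReal.ofReal_ne_top (hLp m) hr hx⟩
  obtain ⟨F, -, hFi, hFb⟩ : ∃ F : EuclideanSpace ℝ (Fin n) → ENNReal, Measurable F ∧
      ∫⁻ x, F x ≠ ⊤ ∧ ∀ m, ∀ x ∈ D, ‖φ m x‖ₑ ^ p ≤ F x := by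
    refine exists_dominating_of_forall_nhds hDb.isCompact_closure fun x hx => ?_
    rw [closure_eq_self_union_frontier] at hx
    rcases hx with hx | hx
    · obtain ⟨r, hr, hball⟩ := Metric.isOpen_iff.1 hDo x hx
      obtain ⟨M, hM⟩ := hb (r / 2) (half_pos hr)
      refine ⟨ball x (r / 2), ball_mem_nhds x (half_pos hr),
        (ball x (r / 2)).indicator fun _ => ENNReal.ofReal M ^ p,
        measurable_const.indicator measurableSet_ball, ?_, fun m y hy => ?_⟩
      · rw [lintegral_indicator_const measurableSet_ball]
        exact ENNReal.mul_ne_top (ENNReal.rpow_ne_top_of_nonneg hp0.le ENNReal.ofReal_ne_top)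
          measure_ball_lt_top.ne
      · rw [Set.indicator_of_mem hy.1, Real.enorm_eq_ofReal_abs]
        have hyD : ball y (r / 2) ⊆ D :=
          (ball_subset_ball' (by linarith [mem_ball.1 hy.1])).trans hball
        exact ENNReal.rpow_le_rpow (ENNReal.ofReal_le_ofReal (hM m y hyD)) hp0.le
    · obtain ⟨α, hα, β, hβ, K, hg⟩ := hch x hx
      exact hg.exists_nhds_dominating one_le_two hα hβ hDo hfr ((hφ 0).nonneg hDc.nonempty) hp0
        hφ hb
  obtain ⟨g, ψ, hg, hψ⟩ :=
    (HasWeightedGradBound.equicontinuous_domRestrict hφ hDo hfr).exists_subseq_tendsto fun x => by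
      obtain ⟨r, hr, hball⟩ := Metric.isOpen_iff.1 hDo x x.2
      obtain ⟨M, hM⟩ := hb r hr
      exact ⟨M, fun m => hM m x hball⟩
  refine ⟨g, Function.extend Subtype.val ψ 0, hg, ?_⟩
  refine tendsto_eLpNorm_sub_of_dominated hp
    (fun m => (hdiff (g m)).continuousOn.aemeasurable hDo.measurableSet)
    (ne_top_of_le_ne_top hFi (setLIntegral_le_lintegral D F)) (fun m => ?_) ?_
  · exact (ae_restrict_iff' hDo.measurableSet).2 (Filter.Eventually.of_forall (hFb (g m)))
  · refine (ae_restrict_iff' hDo.measurableSet).2 (Filter.Eventually.of_forall fun x hx => ?_)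
    rw [Subtype.val_injective.extend_apply ψ 0 ⟨x, hx⟩]
    exact hψ ⟨x, hx⟩
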